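/- arXiv:1606.07755 — 3 statements merged into one kernel-verified Lean document; each statement's English description precedes it below -/
import Mathlib

section
/- Let x ∈ ℝ, h > 0, and let f : ℝ → ℝ be six times continuously differentiable on [x−h, x+h] with |f⁽⁶⁾(t)| ≤ M for all t in that interval. Then |f''(x−h) + 10f''(x) + f''(x+h) − (12/h²)(f(x−h) − 2f(x) + f(x+h))| ≤ (7/60)·M·h⁴; i.e. the uniform-grid compact relation for the second derivative has fourth-order truncation error. -/
/-- If `u 0 = 0` and `|u' s| ≤ C s ^ n` on `[0, h]`, then `|u s| ≤ C s ^ (n + 1) / (n + 1)` there. -/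
lemma abs_le_of_hasDerivWithinAt_Icc_of_abs_deriv_le_pow {u u' : ℝ → ℝ} {h C : ℝ} (n : ℕ)
    (hu : ∀ s ∈ Set.Icc 0 h, HasDerivWithinAt u (u' s) (Set.Icc 0 h) s) (hu0 : u 0 = 0)
    (hb : ∀ s ∈ Set.Icc 0 h, |u' s| ≤ C * s ^ n) :
    ∀ s ∈ Set.Icc 0 h, |u s| ≤ C / (n + 1) * s ^ (n + 1) := by
  have hn : (n + 1 : ℝ) ≠ 0 := by positivity
  have hB : ∀ s, HasDerivAt (fun s : ℝ => C / (n + 1) * s ^ (n + 1)) (C * s ^ n) s := by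
    intro s
    refine ((hasDerivAt_pow (n + 1) s).const_mul (C / (n + 1 : ℝ))).congr_deriv ?_
    rw [Nat.add_sub_cancel]
    push_cast
    field_simp
  intro s hs
  refine image_norm_le_of_norm_deriv_right_le_deriv_boundary
    (fun t ht => (hu t ht).continuousWithinAt) (fun t ht => ?_) (by simp [hu0]) hB
    (fun t ht => hb t (Set.Ico_subset_Icc_self ht)) hs
  exact (hu t (Set.Ico_subset_Icc_self ht)).mono_of_mem_nhdsWithin (Icc_mem_nhdsGE_of_mem ht)

/-- Derivative of the reflected sum `g (x + s) + c * g (x - s)` on a one-sided interval. -/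
lemma hasDerivWithinAt_add_const_mul_reflect {g g' : ℝ → ℝ} {x h : ℝ} (c : ℝ)
    (hg : ∀ t ∈ Set.Icc (x - h) (x + h), HasDerivWithinAt g (g' t) (Set.Icc (x - h) (x + h)) t)
    {s : ℝ} (hs : s ∈ Set.Icc 0 h) :
    HasDerivWithinAt (fun s => g (x + s) + c * g (x - s)) (g' (x + s) - c * g' (x - s))
      (Set.Icc 0 h) s := by
  have hplus : Set.MapsTo (fun s => x + s) (Set.Icc 0 h) (Set.Icc (x - h) (x + h)) := by
    rintro t ⟨h0, h1⟩
    constructor <;> linarith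
  have hminus : Set.MapsTo (fun s => x - s) (Set.Icc 0 h) (Set.Icc (x - h) (x + h)) := by
    rintro t ⟨h0, h1⟩
    constructor <;> linarith
  have h₁ := (hg _ (hplus hs)).comp s ((hasDerivWithinAt_id s _).const_add x) hplus
  have h₂ := (hg _ (hminus hs)).comp s ((hasDerivWithinAt_id s _).const_sub x) hminus
  exact (h₁.add (h₂.const_mul c)).congr_deriv (by ring)

theorem compact_uniform_relation_truncation_error
    (x h M : ℝ) (hh : 0 < h)
    (f : ℝ → ℝ)
    (hf : ContDiffOn ℝ 6 f (Set.Icc (x - h) (x + h)))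
    (hM : ∀ t ∈ Set.Icc (x - h) (x + h),
      |iteratedDerivWithin 6 f (Set.Icc (x - h) (x + h)) t| ≤ M) :
    |iteratedDerivWithin 2 f (Set.Icc (x - h) (x + h)) (x - h)
        + 10 * iteratedDerivWithin 2 f (Set.Icc (x - h) (x + h)) x
        + iteratedDerivWithin 2 f (Set.Icc (x - h) (x + h)) (x + h)
        - (12 / h ^ 2) * (f (x - h) - 2 * f x + f (x + h))|
      ≤ (7 / 60) * M * h ^ 4 := by
  set I := Set.Icc (x - h) (x + h) with hI
  set g : ℕ → ℝ → ℝ := fun k => iteratedDerivWithin k f I with hg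
  have hg0 : g 0 = f := iteratedDerivWithin_zero
  have hud : UniqueDiffOn ℝ I := uniqueDiffOn_Icc (by linarith)
  have hd : ∀ k < 6, ∀ t ∈ I, HasDerivWithinAt (g k) (g (k + 1) t) I t := by
    intro k hk t ht
    have hdiff := (hf.differentiableOn_iteratedDerivWithin (m := k) (by exact_mod_cast hk) hud) t ht
    simpa only [hg, iteratedDerivWithin_succ] using hdiff.hasDerivWithinAt
  have hpow : ∀ (n : ℕ) (c s : ℝ), HasDerivWithinAt (fun s => c * s ^ n) (c * (n * s ^ (n - 1)))
      (Set.Icc 0 h) s := fun n c s => ((hasDerivAt_pow n s).const_mul c).hasDerivWithinAt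
  have bound₆ : ∀ s ∈ Set.Icc 0 h, |g 6 (x + s) + 1 * g 6 (x - s)| ≤ 2 * M * s ^ 0 := by
    rintro s ⟨h0, h1⟩
    have hp := abs_le.1 (hM (x + s) ⟨by linarith, by linarith⟩)
    have hm := abs_le.1 (hM (x - s) ⟨by linarith, by linarith⟩)
    rw [abs_le]
    constructor <;> simp only [hg] <;> linarith
  have bound₅ := abs_le_of_hasDerivWithinAt_Icc_of_abs_deriv_le_pow 0
    (u := fun s => g 5 (x + s) + (-1) * g 5 (x - s))
    (fun s hs => (hasDerivWithinAt_add_const_mul_reflect (-1) (hd 5 (by norm_num)) hs).congr_deriv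
      (by ring)) (by simp) bound₆
  have bound₄ := abs_le_of_hasDerivWithinAt_Icc_of_abs_deriv_le_pow _
    (u := fun s => g 4 (x + s) + 1 * g 4 (x - s) - 2 * g 4 x)
    (fun s hs => ((hasDerivWithinAt_add_const_mul_reflect 1 (hd 4 (by norm_num)) hs).sub_const
      (2 * g 4 x)).congr_deriv (by ring)) (by simp; ring) bound₅
  have bound₃ := abs_le_of_hasDerivWithinAt_Icc_of_abs_deriv_le_pow _
    (u := fun s => g 3 (x + s) + (-1) * g 3 (x - s) - 2 * g 4 x * s ^ 1)
    (fun s hs => ((hasDerivWithinAt_add_const_mul_reflect (-1) (hd 3 (by norm_num)) hs).sub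
      (hpow 1 (2 * g 4 x) s)).congr_deriv (by norm_num)) (by simp) bound₄
  have bound₂ := abs_le_of_hasDerivWithinAt_Icc_of_abs_deriv_le_pow _
    (u := fun s => g 2 (x + s) + 1 * g 2 (x - s) - g 4 x * s ^ 2 - 2 * g 2 x)
    (fun s hs => (((hasDerivWithinAt_add_const_mul_reflect 1 (hd 2 (by norm_num)) hs).sub
      (hpow 2 (g 4 x) s)).sub_const (2 * g 2 x)).congr_deriv (by norm_num; ring))
    (by simp; ring) bound₃
  have bound₁ := abs_le_of_hasDerivWithinAt_Icc_of_abs_deriv_le_pow _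
    (u := fun s => g 1 (x + s) + (-1) * g 1 (x - s) - g 4 x / 3 * s ^ 3 - 2 * g 2 x * s ^ 1)
    (fun s hs => (((hasDerivWithinAt_add_const_mul_reflect (-1) (hd 1 (by norm_num)) hs).sub
      (hpow 3 (g 4 x / 3) s)).sub (hpow 1 (2 * g 2 x) s)).congr_deriv (by norm_num; ring))
    (by simp) bound₂
  have bound₀ := abs_le_of_hasDerivWithinAt_Icc_of_abs_deriv_le_pow _
    (u := fun s => g 0 (x + s) + 1 * g 0 (x - s) - g 4 x / 12 * s ^ 4 - g 2 x * s ^ 2 - 2 * g 0 x)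
    (fun s hs => ((((hasDerivWithinAt_add_const_mul_reflect 1 (hd 0 (by norm_num)) hs).sub
      (hpow 4 (g 4 x / 12) s)).sub (hpow 2 (g 2 x) s)).sub_const (2 * g 0 x)).congr_deriv
      (by norm_num; ring)) (by simp; ring) bound₁
  have hP := bound₂ h ⟨hh.le, le_rfl⟩
  have hQ := bound₀ h ⟨hh.le, le_rfl⟩
  rw [hg0] at hQ
  set P := g 2 (x + h) + 1 * g 2 (x - h) - g 4 x * h ^ 2 - 2 * g 2 x with hPdef
  set Q := f (x + h) + 1 * f (x - h) - g 4 x / 12 * h ^ 4 - g 2 x * h ^ 2 - 2 * f x with hQdef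
  have key : g 2 (x - h) + 10 * g 2 x + g 2 (x + h)
      - (12 / h ^ 2) * (f (x - h) - 2 * f x + f (x + h)) = P - 12 / h ^ 2 * Q := by
    rw [hPdef, hQdef]
    field_simp
    ring
  calc _ = |P - 12 / h ^ 2 * Q| := congrArg _ key
    _ ≤ |P| + |12 / h ^ 2 * Q| := abs_sub _ _
    _ = |P| + 12 / h ^ 2 * |Q| := by rw [abs_mul, abs_of_pos (by positivity : 0 < 12 / h ^ 2)]
    _ ≤ _ := add_le_add hP (mul_le_mul_of_nonneg_left hQ (by positivity))
    _ = 7 / 60 * M * h ^ 4 := by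
      norm_num
      field_simp
      ring
end

section
/- Let x ∈ ℝ, h, k > 0, D = (h+k)(h² + 3hk + k²), and let α = k(h² + hk − k²)/D, β = h(k² + hk − h²)/D, a = 12k/D, b = −12/(h² + 3hk + k²), c = 12h/D be the non-uniform compact scheme coefficients. If f : ℝ → ℝ is five times continuously differentiable on [x−h, x+k] with |f⁽⁵⁾(t)| ≤ M on that interval, then |α·f''(x−h) + f''(x) + β·f''(x+k) − a·f(x−h) − b·f(x) − c·f(x+k)| ≤ M·((|α|·h³ + |β|·k³)/6 + h·k·(h⁴ + k⁴)/(10·D)). -/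
open Set in
/-- If the derivative of `g` grows at most like `C * |t - x| ^ n` and `g x = 0`, then `g` grows at
most like `C * |t - x| ^ (n + 1) / (n + 1)`. -/
lemma Convex.norm_le_mul_abs_pow_succ_of_norm_deriv_le {F : Type*} [NormedAddCommGroup F]
    [NormedSpace ℝ F] {s : Set ℝ} (hs : Convex ℝ s) {g g' : ℝ → F} {x C : ℝ} {n : ℕ}
    (hx : x ∈ s) (hg : ∀ t ∈ s, HasDerivWithinAt g (g' t) s t) (hgx : g x = 0)
    (bound : ∀ t ∈ s, ‖g' t‖ ≤ C * |t - x| ^ n) {t : ℝ} (ht : t ∈ s) :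
    ‖g t‖ ≤ C * |t - x| ^ (n + 1) / (n + 1) := by
  have hmaps : MapsTo (fun u : ℝ => x + u * (t - x)) (Icc 0 1) s := fun u hu => by
    simpa using hs.add_smul_sub_mem hx ht hu
  have hderiv : ∀ u ∈ Icc (0 : ℝ) 1, HasDerivWithinAt (fun u => g (x + u * (t - x)))
      ((t - x) • g' (x + u * (t - x))) (Icc 0 1) u := fun u hu => by
    have hline : HasDerivWithinAt (fun u : ℝ => x + u * (t - x)) (t - x) (Icc 0 1) u := by
      simpa using (((hasDerivAt_id u).mul_const (t - x)).const_add x).hasDerivWithinAt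
    exact (hg _ (hmaps hu)).scomp u hline hmaps
  have hB : ∀ u : ℝ, HasDerivAt (fun u => C * |t - x| ^ (n + 1) / (n + 1) * u ^ (n + 1))
      (C * |t - x| ^ (n + 1) * u ^ n) u := fun u => by
    refine ((hasDerivAt_pow (n + 1) u).const_mul _).congr_deriv ?_
    push_cast
    field_simp
  have key := image_norm_le_of_norm_deriv_right_le_deriv_boundary
    (fun u hu => (hderiv u hu).continuousWithinAt)
    (fun u hu => (hderiv u (Ico_subset_Icc_self hu)).mono_of_mem_nhdsWithin
      (Icc_mem_nhdsGE_of_mem hu))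
    (by simp [hgx]) hB
    (fun u hu => by
      have h := bound _ (hmaps (Ico_subset_Icc_self hu))
      rw [add_sub_cancel_left, abs_mul, abs_of_nonneg hu.1] at h
      rw [norm_smul, Real.norm_eq_abs]
      calc |t - x| * ‖g' (x + u * (t - x))‖
          ≤ |t - x| * (C * (u * |t - x|) ^ n) := by gcongr
        _ = C * |t - x| ^ (n + 1) * u ^ n := by ring)
    (right_mem_Icc.2 zero_le_one)
  simpa using key

/-- **Taylor's theorem** on a convex set, around an arbitrary point of it, for a sequence `d` of
functions each of which is the derivative of the preceding one. -/
lemma Convex.abs_sub_taylor_sum_le {s : Set ℝ} (hs : Convex ℝ s) {x M : ℝ} (hx : x ∈ s) (n : ℕ)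
    (d : ℕ → ℝ → ℝ) (hd : ∀ i < n, ∀ t ∈ s, HasDerivWithinAt (d i) (d (i + 1) t) s t)
    (hM : ∀ t ∈ s, |d n t| ≤ M) {t : ℝ} (ht : t ∈ s) :
    |d 0 t - ∑ j ∈ Finset.range n, d j x * (t - x) ^ j / j.factorial|
      ≤ M / n.factorial * |t - x| ^ n := by
  induction n generalizing d t with
  | zero => simpa using hM t ht
  | succ n ih =>
    have hsum : ∀ u, HasDerivAt
        (fun u => ∑ j ∈ Finset.range (n + 1), d j x * (u - x) ^ j / j.factorial)
        (∑ j ∈ Finset.range n, d (j + 1) x * (u - x) ^ j / j.factorial) u := fun u => by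
      simp only [Finset.sum_range_succ' _ n, pow_zero]
      refine HasDerivAt.add_const _ (HasDerivAt.fun_sum fun j _ => ?_)
      refine (((((hasDerivAt_id u).sub_const x).pow (j + 1)).const_mul (d (j + 1) x)).div_const
        ((j + 1).factorial : ℝ)).congr_deriv ?_
      rw [Nat.factorial_succ]
      push_cast
      simp only [id]
      field_simp
    have h := hs.norm_le_mul_abs_pow_succ_of_norm_deriv_le hx
      (fun u hu => (hd 0 n.succ_pos u hu).sub (hsum u).hasDerivWithinAt)
      (by simp [Finset.sum_range_succ'])
      (fun u hu => ih (fun i => d (i + 1)) (fun i hi => hd (i + 1) (by lia)) hM hu) ht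
    refine h.trans_eq ?_
    rw [Nat.factorial_succ]
    push_cast
    field_simp


theorem compact_nonuniform_relation_truncation_error
    (x h k M : ℝ) (hh : 0 < h) (hk : 0 < k)
    (f : ℝ → ℝ)
    (hf : ContDiffOn ℝ 5 f (Set.Icc (x - h) (x + k)))
    (hM : ∀ t ∈ Set.Icc (x - h) (x + k),
      |iteratedDerivWithin 5 f (Set.Icc (x - h) (x + k)) t| ≤ M) :
    |(k * (h ^ 2 + h * k - k ^ 2) / ((h + k) * (h ^ 2 + 3 * h * k + k ^ 2)))
          * iteratedDerivWithin 2 f (Set.Icc (x - h) (x + k)) (x - h)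
        + iteratedDerivWithin 2 f (Set.Icc (x - h) (x + k)) x
        + (h * (k ^ 2 + h * k - h ^ 2) / ((h + k) * (h ^ 2 + 3 * h * k + k ^ 2)))
          * iteratedDerivWithin 2 f (Set.Icc (x - h) (x + k)) (x + k)
        - (12 * k / ((h + k) * (h ^ 2 + 3 * h * k + k ^ 2))) * f (x - h)
        - (-12 / (h ^ 2 + 3 * h * k + k ^ 2)) * f x
        - (12 * h / ((h + k) * (h ^ 2 + 3 * h * k + k ^ 2))) * f (x + k)|
      ≤ M * ((|k * (h ^ 2 + h * k - k ^ 2) / ((h + k) * (h ^ 2 + 3 * h * k + k ^ 2))| * h ^ 3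
              + |h * (k ^ 2 + h * k - h ^ 2) / ((h + k) * (h ^ 2 + 3 * h * k + k ^ 2))| * k ^ 3) / 6
            + h * k * (h ^ 4 + k ^ 4) / (10 * ((h + k) * (h ^ 2 + 3 * h * k + k ^ 2)))) := by
  set s := Set.Icc (x - h) (x + k)
  have hconv : Convex ℝ s := convex_Icc _ _
  have hx : x ∈ s := ⟨by linarith, by linarith⟩
  have hl : x - h ∈ s := ⟨by linarith, by linarith⟩
  have hr : x + k ∈ s := ⟨by linarith, by linarith⟩
  have hd : ∀ i < 5, ∀ t ∈ s, HasDerivWithinAt (iteratedDerivWithin i f s)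
      (iteratedDerivWithin (i + 1) f s t) s t := fun i hi t ht => by
    rw [iteratedDerivWithin_succ]
    exact (hf.differentiableOn_iteratedDerivWithin (mod_cast hi)
      (uniqueDiffOn_Icc (by linarith)) t ht).hasDerivWithinAt
  have hf_taylor {t : ℝ} (ht : t ∈ s) :=
    hconv.abs_sub_taylor_sum_le hx 5 (fun i => iteratedDerivWithin i f s) hd hM ht
  have hf2_taylor {t : ℝ} (ht : t ∈ s) :=
    hconv.abs_sub_taylor_sum_le hx 3 (fun i => iteratedDerivWithin (i + 2) f s)
      (fun i hi => hd (i + 2) (by lia)) hM ht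
  have hfl := hf_taylor hl
  have hfr := hf_taylor hr
  have hf2l := hf2_taylor hl
  have hf2r := hf2_taylor hr
  simp only [Finset.sum_range_succ, Finset.sum_range_zero, Nat.factorial, iteratedDerivWithin_zero,
    sub_sub_cancel_left, add_sub_cancel_left, abs_neg, abs_of_pos hh, abs_of_pos hk]
    at hfl hfr hf2l hf2r
  norm_num at hfl hfr hf2l hf2r
  set α := k * (h ^ 2 + h * k - k ^ 2) / ((h + k) * (h ^ 2 + 3 * h * k + k ^ 2)) with hα
  set β := h * (k ^ 2 + h * k - h ^ 2) / ((h + k) * (h ^ 2 + 3 * h * k + k ^ 2)) with hβ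
  set a := 12 * k / ((h + k) * (h ^ 2 + 3 * h * k + k ^ 2)) with ha
  set c := 12 * h / ((h + k) * (h ^ 2 + 3 * h * k + k ^ 2)) with hc
  have ha0 : 0 ≤ a := by positivity
  have hc0 : 0 ≤ c := by positivity
  generalize hrl : f (x - h) - _ = rl at hfl
  generalize hrr : f (x + k) - _ = rr at hfr
  generalize hr2l : iteratedDerivWithin 2 f s (x - h) - _ = r2l at hf2l
  generalize hr2r : iteratedDerivWithin 2 f s (x + k) - _ = r2r at hf2r
  calc _ = |α * r2l + β * r2r - a * rl - c * rr| := by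
        congr 1
        rw [← hrl, ← hrr, ← hr2l, ← hr2r, hα, hβ, ha, hc]
        field_simp
        ring
    _ ≤ |α| * |r2l| + |β| * |r2r| + a * |rl| + c * |rr| := by
        nth_rw 2 [← abs_of_nonneg ha0, ← abs_of_nonneg hc0]
        simp only [← abs_mul]
        exact (abs_sub _ _).trans (add_le_add_left ((abs_sub _ _).trans
          (add_le_add_left (abs_add_le _ _) _)) _)
    _ ≤ |α| * (M / 6 * h ^ 3) + |β| * (M / 6 * k ^ 3) + a * (M / 120 * h ^ 5)
        + c * (M / 120 * k ^ 5) := by gcongr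
    _ = _ := by
        rw [ha, hc]
        field_simp
        ring
end

section
/- Let (x, y, z) ∈ ℝ³, let h₁, h₂, k₁, k₂, l₁, l₂ > 0, and define the seven-point non-uniform coefficients a_w = 2/(h₁(h₁+h₂)), a_e = 2/(h₂(h₁+h₂)), a_s = 2/(k₁(k₁+k₂)), a_n = 2/(k₂(k₁+k₂)), a_f = 2/(l₁(l₁+l₂)), a_b = 2/(l₂(l₁+l₂)), a_p = 2/(h₁h₂) + 2/(k₁k₂) + 2/(l₁l₂). Suppose u : ℝ³ → ℝ is such that t ↦ u(t, y, z) is three times continuously differentiable on [x−h₁, x+h₂] with third derivative bounded by M₁, t ↦ u(x, t, z) is three times continuously differentiable on [y−k₁, y+k₂] with third derivative bounded by M₂, and t ↦ u(x, y, t) is three times continuously differentiable on [z−l₁, z+l₂] with third derivative bounded by M₃. Then |a_w u(x−h₁,y,z) + a_e u(x+h₂,y,z) + a_s u(x,y−k₁,z) + a_n u(x,y+k₂,z) + a_f u(x,y,z−l₁) + a_b u(x,y,z+l₂) − a_p u(x,y,z) − (u_xx + u_yy + u_zz)(x,y,z)| ≤ M₁(h₁²+h₂²)/(3(h₁+h₂))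 + M₂(k₁²+k₂²)/(3(k₁+k₂)) + M₃(l₁²+l₂²)/(3(l₁+l₂)). -/
/-- Taylor's theorem with an explicit remainder bound, expanding about an arbitrary point of the
interval and in either direction. -/
theorem abs_sub_taylorWithinEval_le {f : ℝ → ℝ} {a b M x₀ x : ℝ} {n : ℕ}
    (hf : ContDiffOn ℝ (n + 1) f (Set.Icc a b))
    (hM : ∀ t ∈ Set.Icc a b, |iteratedDerivWithin (n + 1) f (Set.Icc a b) t| ≤ M)
    (hx₀ : x₀ ∈ Set.Icc a b) (hx : x ∈ Set.Icc a b) (hne : x₀ ≠ x) :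
    |f x - taylorWithinEval f n (Set.Icc a b) x₀ x|
      ≤ M * |x - x₀| ^ (n + 1) / (n + 1).factorial := by
  have hsub : Set.uIcc x₀ x ⊆ Set.Icc a b := Set.uIcc_subset_Icc hx₀ hx
  have hab : a < b := by
    rcases lt_or_gt_of_ne hne with h | h
    · exact hx₀.1.trans_lt (h.trans_le hx.2)
    · exact hx.1.trans_lt (h.trans_le hx₀.2)
  have hud : UniqueDiffOn ℝ (Set.uIcc x₀ x) :=
    uniqueDiffOn_Icc (inf_lt_sup.2 hne)
  have hderiv {m : ℕ} (hm : m ≤ n + 1) {t : ℝ} (ht : t ∈ Set.uIcc x₀ x) :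
      iteratedDerivWithin m f (Set.uIcc x₀ x) t = iteratedDerivWithin m f (Set.Icc a b) t := by
    rw [iteratedDerivWithin, iteratedDerivWithin,
      iteratedFDerivWithin_subset hsub hud (uniqueDiffOn_Icc hab)
        (hf.of_le (mod_cast hm)) ht]
  have htaylor : taylorWithinEval f n (Set.uIcc x₀ x) x₀ x
      = taylorWithinEval f n (Set.Icc a b) x₀ x := by
    simp only [taylor_within_apply]
    refine Finset.sum_congr rfl fun m hm => ?_
    rw [hderiv (Finset.mem_range.1 hm).le Set.left_mem_uIcc]
  obtain ⟨ξ, hξ, h⟩ := taylor_mean_remainder_lagrange hne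
    ((hf.mono hsub).of_le (by exact_mod_cast n.le_succ))
    (((hf.mono hsub).differentiableOn_iteratedDerivWithin
      (by exact_mod_cast n.lt_succ_self) hud).mono Set.uIoo_subset_uIcc_self)
  have hξ' := Set.uIoo_subset_uIcc_self hξ
  rw [← htaylor, h, hderiv le_rfl hξ', abs_div, abs_mul, abs_pow, Nat.abs_cast]
  gcongr
  exact hM ξ (hsub hξ')

/-- Truncation error of the three-point non-uniform difference quotient for the second
derivative. -/
theorem threepoint_nonuniform_truncation_error {f : ℝ → ℝ} {x h₁ h₂ M : ℝ}
    (hh₁ : 0 < h₁) (hh₂ : 0 < h₂)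
    (hf : ContDiffOn ℝ 3 f (Set.Icc (x - h₁) (x + h₂)))
    (hM : ∀ t ∈ Set.Icc (x - h₁) (x + h₂),
      |iteratedDerivWithin 3 f (Set.Icc (x - h₁) (x + h₂)) t| ≤ M) :
    |(2 / (h₁ * (h₁ + h₂))) * f (x - h₁) + (2 / (h₂ * (h₁ + h₂))) * f (x + h₂)
        - 2 / (h₁ * h₂) * f x - iteratedDerivWithin 2 f (Set.Icc (x - h₁) (x + h₂)) x|
      ≤ M * (h₁ ^ 2 + h₂ ^ 2) / (3 * (h₁ + h₂)) := by
  have hf' : ContDiffOn ℝ ((2 : ℕ) + 1) f (Set.Icc (x - h₁) (x + h₂)) :=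
    hf.of_le (by norm_num)
  have hleft := abs_sub_taylorWithinEval_le (x₀ := x) (x := x - h₁) hf' hM
    (by constructor <;> linarith) (by constructor <;> linarith) (by linarith)
  have hright := abs_sub_taylorWithinEval_le (x₀ := x) (x := x + h₂) hf' hM
    (by constructor <;> linarith) (by constructor <;> linarith) (by linarith)
  set s := Set.Icc (x - h₁) (x + h₂)
  have habs₁ : |x - h₁ - x| = h₁ := by rw [sub_sub_cancel_left, abs_neg, abs_of_pos hh₁]
  have habs₂ : |x + h₂ - x| = h₂ := by rw [add_sub_cancel_left, abs_of_pos hh₂]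
  rw [habs₁] at hleft
  rw [habs₂] at hright
  set R₁ := f (x - h₁) - taylorWithinEval f 2 s x (x - h₁) with hR₁
  set R₂ := f (x + h₂) - taylorWithinEval f 2 s x (x + h₂) with hR₂
  simp only [taylor_within_apply, Finset.sum_range_succ, Finset.sum_range_zero,
    iteratedDerivWithin_zero, smul_eq_mul, Nat.factorial] at hR₁ hR₂
  have hsplit : (2 / (h₁ * (h₁ + h₂))) * f (x - h₁) + (2 / (h₂ * (h₁ + h₂))) * f (x + h₂)
        - 2 / (h₁ * h₂) * f x - iteratedDerivWithin 2 f s x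
      = 2 / (h₁ * (h₁ + h₂)) * R₁ + 2 / (h₂ * (h₁ + h₂)) * R₂ := by
    rw [hR₁, hR₂]
    field_simp
    push_cast
    ring
  rw [hsplit]
  calc
    _ ≤ |2 / (h₁ * (h₁ + h₂)) * R₁| + |2 / (h₂ * (h₁ + h₂)) * R₂| := abs_add_le _ _
    _ = 2 / (h₁ * (h₁ + h₂)) * |R₁| + 2 / (h₂ * (h₁ + h₂)) * |R₂| := by
      rw [abs_mul, abs_mul, abs_of_pos (by positivity : 0 < 2 / (h₁ * (h₁ + h₂))),
        abs_of_pos (by positivity : 0 < 2 / (h₂ * (h₁ + h₂)))]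
    _ ≤ 2 / (h₁ * (h₁ + h₂)) * (M * h₁ ^ (2 + 1) / (2 + 1).factorial)
        + 2 / (h₂ * (h₁ + h₂)) * (M * h₂ ^ (2 + 1) / (2 + 1).factorial) := by gcongr
    _ = M * (h₁ ^ 2 + h₂ ^ 2) / (3 * (h₁ + h₂)) := by
      simp only [Nat.factorial]
      field_simp
      push_cast
      ring

theorem sevenpoint_nonuniform_laplacian_truncation_error
    (x y z h₁ h₂ k₁ k₂ l₁ l₂ M₁ M₂ M₃ : ℝ)
    (hh₁ : 0 < h₁) (hh₂ : 0 < h₂) (hk₁ : 0 < k₁) (hk₂ : 0 < k₂)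
    (hl₁ : 0 < l₁) (hl₂ : 0 < l₂)
    (u : ℝ → ℝ → ℝ → ℝ)
    (hux : ContDiffOn ℝ 3 (fun t => u t y z) (Set.Icc (x - h₁) (x + h₂)))
    (hMx : ∀ t ∈ Set.Icc (x - h₁) (x + h₂),
      |iteratedDerivWithin 3 (fun t => u t y z) (Set.Icc (x - h₁) (x + h₂)) t| ≤ M₁)
    (huy : ContDiffOn ℝ 3 (fun t => u x t z) (Set.Icc (y - k₁) (y + k₂)))
    (hMy : ∀ t ∈ Set.Icc (y - k₁) (y + k₂),
      |iteratedDerivWithin 3 (fun t => u x t z) (Set.Icc (y - k₁) (y + k₂)) t| ≤ M₂)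
    (huz : ContDiffOn ℝ 3 (fun t => u x y t) (Set.Icc (z - l₁) (z + l₂)))
    (hMz : ∀ t ∈ Set.Icc (z - l₁) (z + l₂),
      |iteratedDerivWithin 3 (fun t => u x y t) (Set.Icc (z - l₁) (z + l₂)) t| ≤ M₃) :
    |(2 / (h₁ * (h₁ + h₂))) * u (x - h₁) y z
        + (2 / (h₂ * (h₁ + h₂))) * u (x + h₂) y z
        + (2 / (k₁ * (k₁ + k₂))) * u x (y - k₁) z
        + (2 / (k₂ * (k₁ + k₂))) * u x (y + k₂) z
        + (2 / (l₁ * (l₁ + l₂))) * u x y (z - l₁)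
        + (2 / (l₂ * (l₁ + l₂))) * u x y (z + l₂)
        - (2 / (h₁ * h₂) + 2 / (k₁ * k₂) + 2 / (l₁ * l₂)) * u x y z
        - (iteratedDerivWithin 2 (fun t => u t y z) (Set.Icc (x - h₁) (x + h₂)) x
            + iteratedDerivWithin 2 (fun t => u x t z) (Set.Icc (y - k₁) (y + k₂)) y
            + iteratedDerivWithin 2 (fun t => u x y t) (Set.Icc (z - l₁) (z + l₂)) z)|
      ≤ M₁ * (h₁ ^ 2 + h₂ ^ 2) / (3 * (h₁ + h₂))
        + M₂ * (k₁ ^ 2 + k₂ ^ 2) / (3 * (k₁ + k₂))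
        + M₃ * (l₁ ^ 2 + l₂ ^ 2) / (3 * (l₁ + l₂)) := by
  have hx := abs_le.1 (threepoint_nonuniform_truncation_error hh₁ hh₂ hux hMx)
  have hy := abs_le.1 (threepoint_nonuniform_truncation_error hk₁ hk₂ huy hMy)
  have hz := abs_le.1 (threepoint_nonuniform_truncation_error hl₁ hl₂ huz hMz)
  rw [abs_le]
  constructor <;> linarith [hx.1, hx.2, hy.1, hy.2, hz.1, hz.2]
end
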